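/- If three points A, B, C are chosen independently and uniformly at random from the unit square [0,1]², then the probability that the triangle ABC is obtuse equals 97/150 + π/40; equivalently, the Lebesgue measure of the set of triples (A,B,C) ∈ ([0,1]²)³ ⊆ (ℝ²)³ that are obtuse equals 97/150 + π/40. -/

import Mathlib

open MeasureTheory

/-- The squared Euclidean distance between two points of the plane `ℝ × ℝ`. -/
def sqDist (P Q : ℝ × ℝ) : ℝ := (P.1 - Q.1) ^ 2 + (P.2 - Q.2) ^ 2

/-- A triple of points `A, B, C` of the plane is obtuse if, with squared side
lengths `p = ‖B - C‖²`, `q = ‖A - C‖²`, `r = ‖A - B‖²`, one of `p > q + r`,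
`q > p + r`, `r > p + q` holds. -/
def IsObtuse (A B C : ℝ × ℝ) : Prop :=
  sqDist B C > sqDist A C + sqDist A B ∨
  sqDist A C > sqDist B C + sqDist A B ∨
  sqDist A B > sqDist B C + sqDist A C

open Set
open scoped ENNReal

theorem setLIntegral_Ioo_ofReal_deriv {F f : ℝ → ℝ} {a b : ℝ} (hab : a ≤ b)
    (hF : ContinuousOn F (Icc a b)) (hf : ∀ x ∈ Ioo a b, HasDerivAt F (f x) x)
    (hf₀ : ∀ x ∈ Ioo a b, 0 ≤ f x) :
    ∫⁻ x in Ioo a b, ENNReal.ofReal (f x) = ENNReal.ofReal (F b - F a) := by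
  have hfi := intervalIntegral.integrableOn_deriv_of_nonneg hF hf hf₀
  rw [← intervalIntegral.integral_eq_sub_of_hasDerivAt_of_le hab hF hf
      ((intervalIntegrable_iff_integrableOn_Ioc_of_le hab).2 hfi),
    intervalIntegral.integral_of_le hab, integral_Ioc_eq_integral_Ioo,
    ofReal_integral_eq_lintegral_ofReal (hfi.mono_set Ioo_subset_Ioc_self)]
  exact (ae_restrict_iff' measurableSet_Ioo).2 (.of_forall hf₀)

theorem setLIntegral_Ioo_split (f : ℝ → ℝ≥0∞) {a b c : ℝ} (hab : a < b) (hbc : b < c) :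
    ∫⁻ x in Ioo a c, f x = (∫⁻ x in Ioo a b, f x) + ∫⁻ x in Ioo b c, f x := by
  rw [← Ioo_union_Ico_eq_Ioo hab hbc.le, lintegral_union measurableSet_Ico,
    setLIntegral_congr (Ioo_ae_eq_Ico (a := b) (b := c))]
  exact disjoint_left.2 fun x (hx : x ∈ Ioo a b) (hx' : x ∈ Ico b c) => hx'.1.not_gt hx.2

theorem setLIntegral_Ioo_comp_sub (g : ℝ → ℝ≥0∞) {a : ℝ} (ha : a ∈ Ioo (0 : ℝ) 1) :
    ∫⁻ b in Ioo (0 : ℝ) 1, g (b - a) =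
      (∫⁻ x in Ioo 0 a, g (-x)) + ∫⁻ x in Ioo 0 (1 - a), g x := by
  rw [setLIntegral_Ioo_split _ ha.1 ha.2]
  congr 1
  · have h := (Measure.measurePreserving_sub_left volume a).setLIntegral_comp_preimage_emb
      (MeasurableEquiv.subLeft a).measurableEmbedding (fun x => g (-x)) (Ioo 0 a)
    simpa using h
  · have h := (measurePreserving_sub_right volume a).setLIntegral_comp_preimage_emb
      (MeasurableEquiv.subRight a).measurableEmbedding g (Ioo 0 (1 - a))
    simpa using h

/-- The integral of `f (x * y)` over the rectangle `(0, p) × (0, q)`. -/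
noncomputable def rectLIntegral (f : ℝ → ℝ≥0∞) (p q : ℝ) : ℝ≥0∞ :=
  ∫⁻ x in Ioo 0 p, ∫⁻ y in Ioo 0 q, f (x * y)

/-- Lebesgue measure on the open unit interval. -/
noncomputable def unitMeasure : Measure ℝ := volume.restrict (Ioo 0 1)

instance : IsProbabilityMeasure unitMeasure := ⟨by simp [unitMeasure]⟩

/-- The distribution of `(b - a) * (c - a)` for independent uniform `a, b, c ∈ (0, 1)`. -/
noncomputable def gapLaw : Measure ℝ :=
  (unitMeasure.prod (unitMeasure.prod unitMeasure)).map
    fun p => (p.2.1 - p.1) * (p.2.2 - p.1)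

theorem measurable_gap :
    Measurable fun p : ℝ × ℝ × ℝ => (p.2.1 - p.1) * (p.2.2 - p.1) := by fun_prop

instance : IsProbabilityMeasure gapLaw :=
  Measure.isProbabilityMeasure_map measurable_gap.aemeasurable

theorem lintegral_gapLaw {f : ℝ → ℝ≥0∞} (hf : Measurable f) :
    ∫⁻ u, f u ∂gapLaw = ∫⁻ a in Ioo (0 : ℝ) 1,
      (rectLIntegral f a a + rectLIntegral (fun u => f (-u)) a (1 - a)) +
      (rectLIntegral (fun u => f (-u)) (1 - a) a + rectLIntegral f (1 - a) (1 - a)) := by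
  have hfm : Measurable fun p : ℝ × ℝ × ℝ => f ((p.2.1 - p.1) * (p.2.2 - p.1)) :=
    hf.comp measurable_gap
  rw [gapLaw, lintegral_map hf measurable_gap, lintegral_prod _ hfm.aemeasurable]
  refine setLIntegral_congr_fun measurableSet_Ioo fun a ha => ?_
  have hfa : Measurable fun p : ℝ × ℝ => f ((p.1 - a) * (p.2 - a)) := hf.comp (by fun_prop)
  have hin (x : ℝ) : ∫⁻ c in Ioo (0 : ℝ) 1, f (x * (c - a)) =
      (∫⁻ y in Ioo 0 a, f (x * -y)) + ∫⁻ y in Ioo 0 (1 - a), f (x * y) :=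
    setLIntegral_Ioo_comp_sub (fun y => f (x * y)) ha
  have hmeas (s : Set ℝ) : Measurable fun x => ∫⁻ y in s, f (x * y) :=
    Measurable.lintegral_prod_right' (f := fun p : ℝ × ℝ => f (p.1 * p.2)) (hf.comp (by fun_prop))
  have hmeas' (s : Set ℝ) : Measurable fun x => ∫⁻ y in s, f (-(x * y)) :=
    Measurable.lintegral_prod_right' (f := fun p : ℝ × ℝ => f (-(p.1 * p.2)))
      (hf.comp (by fun_prop))
  dsimp only
  rw [lintegral_prod _ hfa.aemeasurable]
  simp only [unitMeasure, hin]
  rw [setLIntegral_Ioo_comp_sub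
    (fun x => (∫⁻ y in Ioo 0 a, f (x * -y)) + ∫⁻ y in Ioo 0 (1 - a), f (x * y)) ha]
  simp only [neg_mul, mul_neg, neg_neg, rectLIntegral]
  rw [lintegral_add_left (hmeas _), lintegral_add_left (hmeas' _)]

theorem measurePreserving_prodProdProdComm {α β γ δ : Type*} [MeasurableSpace α]
    [MeasurableSpace β] [MeasurableSpace γ] [MeasurableSpace δ] (μ : Measure α) (ν : Measure β)
    (ρ : Measure γ) (τ : Measure δ) [SFinite μ] [SFinite ν] [SFinite ρ] [SFinite τ] :
    MeasurePreserving (fun p : (α × β) × γ × δ => ((p.1.1, p.2.1), (p.1.2, p.2.2)))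
      ((μ.prod ν).prod (ρ.prod τ)) ((μ.prod ρ).prod (ν.prod τ)) := by
  have h₁ := measurePreserving_prodAssoc μ ν (ρ.prod τ)
  have h₂ := (measurePreserving_prodAssoc ν ρ τ).symm
  have h₃ := (Measure.measurePreserving_swap (μ := ν) (ν := ρ)).prod (MeasurePreserving.id τ)
  have h₄ := measurePreserving_prodAssoc ρ ν τ
  have h₅ := (measurePreserving_prodAssoc μ ρ (ν.prod τ)).symm
  exact h₅.comp (((MeasurePreserving.id μ).prod (h₄.comp (h₃.comp h₂))).comp h₁)

/-- The area of the part of the square `(0, L) × (0, L)` on which `x * y < s ^ 2`. -/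
noncomputable def hyperbolaArea (s L : ℝ) : ℝ :=
  if L ≤ s then L ^ 2 else s ^ 2 * (1 + 2 * (Real.log L - Real.log s))

theorem lintegral_indicator_mul {s L x : ℝ} (hx : x ∈ Ioo 0 L) :
    ∫⁻ y in Ioo 0 L, (Ico 0 (s ^ 2)).indicator (1 : ℝ → ℝ≥0∞) (x * y) =
      ENNReal.ofReal (min L (s ^ 2 / x)) := by
  have hset : (fun y => x * y) ⁻¹' Ico 0 (s ^ 2) ∩ Ioo 0 L = Ioo 0 (min L (s ^ 2 / x)) := by
    ext y
    simp only [mem_inter_iff, mem_preimage, mem_Ico, mem_Ioo, lt_min_iff, lt_div_iff₀ hx.1]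
    constructor
    · rintro ⟨⟨-, h₁⟩, h₂, h₃⟩
      exact ⟨h₂, h₃, by linarith⟩
    · rintro ⟨h₁, h₂, h₃⟩
      exact ⟨⟨mul_nonneg hx.1.le h₁.le, by linarith⟩, h₁, h₂⟩
  have hm : MeasurableSet ((fun y => x * y) ⁻¹' Ico 0 (s ^ 2)) :=
    measurableSet_Ico.preimage (by fun_prop)
  have heq : (fun y => (Ico 0 (s ^ 2)).indicator (1 : ℝ → ℝ≥0∞) (x * y)) =
      ((fun y => x * y) ⁻¹' Ico 0 (s ^ 2)).indicator 1 := rfl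
  rw [heq, lintegral_indicator_one hm, Measure.restrict_apply hm, hset, Real.volume_Ioo, sub_zero]

theorem rectLIntegral_indicator {s L : ℝ} (hs : 0 < s) (hL : 0 < L) :
    rectLIntegral ((Ico 0 (s ^ 2)).indicator 1) L L = ENNReal.ofReal (hyperbolaArea s L) := by
  rw [rectLIntegral, setLIntegral_congr_fun measurableSet_Ioo fun x hx =>
    lintegral_indicator_mul (s := s) hx]
  unfold hyperbolaArea
  split_ifs with h
  · have hmin : ∀ x ∈ Ioo 0 L, ENNReal.ofReal (min L (s ^ 2 / x)) = ENNReal.ofReal L := by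
      intro x hx
      rw [min_eq_left]
      rw [le_div_iff₀ hx.1]
      nlinarith [hx.1, hx.2]
    rw [setLIntegral_congr_fun measurableSet_Ioo hmin, setLIntegral_const, Real.volume_Ioo,
      sub_zero, ← ENNReal.ofReal_mul hL.le, sq]
  · push Not at h
    have hc : 0 < s ^ 2 / L := by positivity
    have hcL : s ^ 2 / L < L := by rw [div_lt_iff₀ hL]; nlinarith
    have hmin : ∀ x ∈ Ioo 0 (s ^ 2 / L),
        ENNReal.ofReal (min L (s ^ 2 / x)) = ENNReal.ofReal L := by
      intro x hx
      have := (lt_div_iff₀ hL).1 hx.2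
      rw [min_eq_left]
      rw [le_div_iff₀ hx.1]
      linarith
    have hmin' : ∀ x ∈ Ioo (s ^ 2 / L) L,
        ENNReal.ofReal (min L (s ^ 2 / x)) = ENNReal.ofReal (s ^ 2 * x⁻¹) := by
      intro x hx
      have := (div_lt_iff₀ hL).1 hx.1
      rw [min_eq_right, div_eq_mul_inv]
      rw [div_le_iff₀ (hc.trans hx.1)]
      linarith
    rw [setLIntegral_Ioo_split _ hc hcL, setLIntegral_congr_fun measurableSet_Ioo hmin,
      setLIntegral_congr_fun measurableSet_Ioo hmin', setLIntegral_const, Real.volume_Ioo,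
      setLIntegral_Ioo_ofReal_deriv (F := fun x => s ^ 2 * Real.log x) hcL.le, sub_zero,
      ← ENNReal.ofReal_mul hL.le, ← ENNReal.ofReal_add (by positivity)]
    · congr 1
      rw [Real.log_div (by positivity) hL.ne', Real.log_pow]
      field_simp
      push_cast
      ring
    · exact sub_nonneg.2 (mul_le_mul_of_nonneg_left (Real.log_le_log hc hcL.le) (sq_nonneg s))
    · exact continuousOn_const.mul (Real.continuousOn_log.mono fun x hx => (hc.trans_le hx.1).ne')
    · exact fun x hx => (Real.hasDerivAt_log (hc.trans hx.1).ne').const_mul _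
    · intro x hx
      have := hc.trans hx.1
      positivity

theorem measurable_hyperbolaArea (s : ℝ) : Measurable (hyperbolaArea s) :=
  Measurable.ite measurableSet_Iic (by fun_prop) (by fun_prop)

theorem lintegral_hyperbolaArea {s : ℝ} (hs : 0 < s) (hs₁ : s < 1) :
    ∫⁻ L in Ioo (0 : ℝ) 1, ENNReal.ofReal (hyperbolaArea s L) =
      ENNReal.ofReal (s ^ 2 * (-1 - 2 * Real.log s + 4 / 3 * s)) := by
  have h₁ : ∀ L ∈ Ioo 0 s, ENNReal.ofReal (hyperbolaArea s L) = ENNReal.ofReal (L ^ 2) :=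
    fun L hL => by rw [hyperbolaArea, if_pos hL.2.le]
  have h₂ : ∀ L ∈ Ioo s 1, ENNReal.ofReal (hyperbolaArea s L) =
      ENNReal.ofReal (s ^ 2 * (1 + 2 * (Real.log L - Real.log s))) :=
    fun L hL => by rw [hyperbolaArea, if_neg hL.1.not_ge]
  rw [setLIntegral_Ioo_split _ hs hs₁, setLIntegral_congr_fun measurableSet_Ioo h₁,
    setLIntegral_congr_fun measurableSet_Ioo h₂,
    setLIntegral_Ioo_ofReal_deriv (F := fun L => L ^ 3 / 3) hs.le,
    setLIntegral_Ioo_ofReal_deriv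
      (F := fun L => s ^ 2 * (2 * (L * Real.log L) - L - 2 * Real.log s * L)) hs₁.le,
    ← ENNReal.ofReal_add]
  · congr 1
    simp only [Real.log_one]
    ring
  · norm_num
    positivity
  · have h : 0 ≤ -1 - 2 * Real.log s + s := by
      have h₃ := Real.log_le_sub_one_of_pos hs
      linarith
    simp only [Real.log_one]
    nlinarith [mul_nonneg (sq_nonneg s) h]
  · fun_prop
  · intro x hx
    have hd := (Real.hasDerivAt_mul_log (hs.trans hx.1).ne').const_mul 2
    refine (((hd.sub (hasDerivAt_id x)).sub
      ((hasDerivAt_id x).const_mul (2 * Real.log s))).const_mul (s ^ 2)).congr_deriv ?_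
    ring
  · intro x hx
    have := Real.log_le_log hs hx.1.le
    have : 0 ≤ Real.log x - Real.log s := by linarith
    positivity
  · fun_prop
  · intro x hx
    exact ((hasDerivAt_pow 3 x).div_const 3).congr_deriv (by norm_num)
  · intro x hx
    positivity

theorem rectLIntegral_eq_zero {f : ℝ → ℝ≥0∞} (hf : ∀ u > 0, f u = 0) (p q : ℝ) :
    rectLIntegral f p q = 0 := by
  have h : ∀ x ∈ Ioo 0 p, ∫⁻ y in Ioo 0 q, f (x * y) = 0 := fun x hx => by
    rw [setLIntegral_congr_fun measurableSet_Ioo fun y hy => hf _ (mul_pos hx.1 hy.1)]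
    simp
  rw [rectLIntegral, setLIntegral_congr_fun measurableSet_Ioo h]
  simp

theorem setLIntegral_Ioo_one_sub (g : ℝ → ℝ≥0∞) :
    ∫⁻ a in Ioo (0 : ℝ) 1, g (1 - a) = ∫⁻ a in Ioo (0 : ℝ) 1, g a := by
  simpa using (Measure.measurePreserving_sub_left volume (1 : ℝ)).setLIntegral_comp_preimage_emb
    (MeasurableEquiv.subLeft (1 : ℝ)).measurableEmbedding g (Ioo 0 1)

theorem gapLaw_Ico_sq {s : ℝ} (hs : 0 < s) (hs₁ : s < 1) :
    gapLaw (Ico 0 (s ^ 2)) =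
      ENNReal.ofReal (s ^ 2 * (-2 - 4 * Real.log s + 8 / 3 * s)) := by
  rw [← lintegral_indicator_one measurableSet_Ico,
    lintegral_gapLaw (measurable_one.indicator measurableSet_Ico)]
  have hneg (p q : ℝ) :
      rectLIntegral (fun u => (Ico 0 (s ^ 2)).indicator (1 : ℝ → ℝ≥0∞) (-u)) p q = 0 :=
    rectLIntegral_eq_zero (fun u hu => indicator_of_notMem (by simp [hu]) _) p q
  have hrect : ∀ a ∈ Ioo (0 : ℝ) 1,
      (rectLIntegral ((Ico 0 (s ^ 2)).indicator 1) a a +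
        rectLIntegral (fun u => (Ico 0 (s ^ 2)).indicator (1 : ℝ → ℝ≥0∞) (-u)) a (1 - a)) +
      (rectLIntegral (fun u => (Ico 0 (s ^ 2)).indicator (1 : ℝ → ℝ≥0∞) (-u)) (1 - a) a +
        rectLIntegral ((Ico 0 (s ^ 2)).indicator 1) (1 - a) (1 - a)) =
      ENNReal.ofReal (hyperbolaArea s a) + ENNReal.ofReal (hyperbolaArea s (1 - a)) := by
    intro a ha
    rw [hneg, hneg, rectLIntegral_indicator hs ha.1, rectLIntegral_indicator hs (sub_pos.2 ha.2),
      add_zero, zero_add]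
  rw [setLIntegral_congr_fun measurableSet_Ioo hrect,
    lintegral_add_left (measurable_hyperbolaArea s).ennreal_ofReal,
    setLIntegral_Ioo_one_sub (fun a => ENNReal.ofReal (hyperbolaArea s a)),
    lintegral_hyperbolaArea hs hs₁, ← two_mul, ← ENNReal.ofReal_ofNat,
    ← ENNReal.ofReal_mul (by norm_num)]
  congr 1
  ring

theorem two_sub_two_mul_sqrt_le_neg_log {x : ℝ} (hx : 0 < x) :
    2 - 2 * √x ≤ -Real.log x := by
  have h := Real.log_le_sub_one_of_pos (Real.sqrt_pos.2 hx)
  rw [Real.log_sqrt hx.le] at h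
  linarith

theorem gapLaw_Ico_mul {x y : ℝ} (hx : x ∈ Ioo (0 : ℝ) 1) (hy : y ∈ Ioo (0 : ℝ) 1) :
    gapLaw (Ico 0 (x * y)) = ENNReal.ofReal
      (x * y * (-2 - 2 * Real.log x - 2 * Real.log y + 8 / 3 * (√x * √y))) := by
  have hxy : 0 < x * y := mul_pos hx.1 hy.1
  have h := gapLaw_Ico_sq (Real.sqrt_pos.2 hxy) ((Real.sqrt_lt' one_pos).2
    (by nlinarith [hx.1, hx.2, hy.1, hy.2]))
  rw [Real.sq_sqrt hxy.le, Real.log_sqrt hxy.le, Real.log_mul hx.1.ne' hy.1.ne',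
    Real.sqrt_mul hx.1.le] at h
  rw [h]
  congr 1
  ring

theorem sqrt_mul_sqrt_lt_one {x y : ℝ} (hx : x ∈ Ioo (0 : ℝ) 1) (hy : y ∈ Ioo (0 : ℝ) 1) :
    √x * √y < 1 :=
  mul_lt_one_of_nonneg_of_lt_one_left (Real.sqrt_nonneg x)
    ((Real.sqrt_lt' one_pos).2 (by simpa using hx.2))
    ((Real.sqrt_lt' one_pos).2 (by simpa using hy.2)).le

theorem two_sub_le_neg_log_sub_log {x y : ℝ} (hx : 0 < x) (hy : 0 < y) :
    2 - 2 * (√x * √y) ≤ -Real.log x - Real.log y := by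
  have h := two_sub_two_mul_sqrt_le_neg_log (mul_pos hx hy)
  rw [Real.log_mul hx.ne' hy.ne', Real.sqrt_mul hx.le] at h
  linarith

theorem hasDerivAt_sq_mul_sqrt {x : ℝ} (hx : 0 < x) :
    HasDerivAt (fun y => y ^ 2 * √y) (5 / 2 * (x * √x)) x := by
  refine ((hasDerivAt_pow 2 x).mul (Real.hasDerivAt_sqrt hx.ne')).congr_deriv ?_
  have h := Real.sq_sqrt hx.le
  have h' : √x ≠ 0 := (Real.sqrt_pos.2 hx).ne'
  field_simp
  rw [h]
  push_cast
  ring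

theorem hasDerivAt_mul_mul_log {x : ℝ} (hx : 0 < x) :
    HasDerivAt (fun y => y * (y * Real.log y)) (2 * (x * Real.log x) + x) x := by
  refine ((hasDerivAt_id x).mul (Real.hasDerivAt_mul_log hx.ne')).congr_deriv ?_
  simp only [id]
  ring

theorem rectLIntegral_gapLaw_inner {x q : ℝ} (hx : x ∈ Ioo (0 : ℝ) 1) (hq : q ∈ Ioo (0 : ℝ) 1) :
    ∫⁻ y in Ioo 0 q, gapLaw (Ico 0 (x * y)) = ENNReal.ofReal
      (q ^ 2 * (x * (-(1 / 2) - Real.log x - Real.log q + 16 / 15 * (√x * √q)))) := by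
  have hy {y : ℝ} (hy : y ∈ Ioo 0 q) : y ∈ Ioo (0 : ℝ) 1 := ⟨hy.1, hy.2.trans hq.2⟩
  rw [setLIntegral_congr_fun measurableSet_Ioo fun y h => gapLaw_Ico_mul hx (hy h),
    setLIntegral_Ioo_ofReal_deriv (F := fun y => x * (-(1 / 2) * y ^ 2 - Real.log x * y ^ 2 -
      y * (y * Real.log y) + 16 / 15 * √x * (y ^ 2 * √y))) hq.1.le]
  · congr 1
    simp only [zero_mul, mul_zero, ne_eq, OfNat.ofNat_ne_zero, not_false_eq_true, zero_pow]
    ring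
  · fun_prop
  · intro y h
    have h₂ := hasDerivAt_pow 2 y
    refine (((((h₂.const_mul (-(1 / 2))).sub (h₂.const_mul (Real.log x))).sub
      (hasDerivAt_mul_mul_log h.1)).add
      ((hasDerivAt_sq_mul_sqrt h.1).const_mul (16 / 15 * √x))).const_mul x).congr_deriv ?_
    push_cast
    ring
  · intro y h
    have h₁ := two_sub_le_neg_log_sub_log hx.1 h.1
    have h₂ := sqrt_mul_sqrt_lt_one hx (hy h)
    exact mul_nonneg (mul_pos hx.1 h.1).le (by linarith)

theorem rectLIntegral_gapLaw {p q : ℝ} (hp : p ∈ Ioo (0 : ℝ) 1) (hq : q ∈ Ioo (0 : ℝ) 1) :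
    rectLIntegral (fun u => gapLaw (Ico 0 u)) p q = ENNReal.ofReal
      (p ^ 2 * q ^ 2 * (-(Real.log p + Real.log q) / 2 + 32 / 75 * (√p * √q))) := by
  have hx {x : ℝ} (hx : x ∈ Ioo 0 p) : x ∈ Ioo (0 : ℝ) 1 := ⟨hx.1, hx.2.trans hp.2⟩
  rw [rectLIntegral, setLIntegral_congr_fun measurableSet_Ioo fun x h =>
      rectLIntegral_gapLaw_inner (hx h) hq,
    setLIntegral_Ioo_ofReal_deriv (F := fun x => q ^ 2 * (-(Real.log q / 2) * x ^ 2 -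
      1 / 2 * (x * (x * Real.log x)) + 32 / 75 * √q * (x ^ 2 * √x))) hp.1.le]
  · congr 1
    simp only [zero_mul, mul_zero, ne_eq, OfNat.ofNat_ne_zero, not_false_eq_true, zero_pow]
    ring
  · fun_prop
  · intro x h
    refine (((((hasDerivAt_pow 2 x).const_mul (-(Real.log q / 2))).sub
      ((hasDerivAt_mul_mul_log h.1).const_mul (1 / 2))).add
      ((hasDerivAt_sq_mul_sqrt h.1).const_mul (32 / 75 * √q))).const_mul (q ^ 2)).congr_deriv ?_
    push_cast
    ring
  · intro x h
    have h₁ := two_sub_le_neg_log_sub_log h.1 hq.1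
    have h₂ := sqrt_mul_sqrt_lt_one (hx h) hq
    exact mul_nonneg (sq_nonneg q) (mul_nonneg h.1.le (by linarith))

theorem lintegral_sq_mul_sq_mul_log :
    ∫⁻ a in Ioo (0 : ℝ) 1, ENNReal.ofReal (a ^ 2 * (1 - a) ^ 2 * -Real.log a) =
      ENNReal.ofReal (47 / 1800) := by
  rw [setLIntegral_Ioo_ofReal_deriv (F := fun a => a ^ 3 / 9 - a ^ 4 / 8 + a ^ 5 / 25 -
    (a ^ 2 / 3 - a ^ 3 / 2 + a ^ 4 / 5) * (a * Real.log a)) zero_le_one]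
  · norm_num
  · fun_prop
  · intro a ha
    have hd := ((((hasDerivAt_pow 2 a).div_const 3).sub ((hasDerivAt_pow 3 a).div_const 2)).add
      ((hasDerivAt_pow 4 a).div_const 5)).mul (Real.hasDerivAt_mul_log ha.1.ne')
    refine (((((hasDerivAt_pow 3 a).div_const 9).sub ((hasDerivAt_pow 4 a).div_const 8)).add
      ((hasDerivAt_pow 5 a).div_const 25)).sub hd).congr_deriv ?_
    simp only [Pi.add_apply, Pi.sub_apply]
    push_cast
    ring
  · intro a ha
    have := Real.log_nonpos ha.1.le ha.2.le
    exact mul_nonneg (by positivity) (by linarith)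

theorem integral_sq_mul_sqrt_mul_one_sub :
    ∫ a in (0 : ℝ)..1, (a * (1 - a)) ^ 2 * √(a * (1 - a)) = 5 * Real.pi / 1024 := by
  have h := intervalIntegral.integral_comp_mul_deriv (a := 0) (b := Real.pi)
    (f := fun θ => (1 - Real.cos θ) / 2) (f' := fun θ => Real.sin θ / 2)
    (g := fun a => (a * (1 - a)) ^ 2 * √(a * (1 - a)))
    (fun θ _ => by
      simpa using ((Real.hasDerivAt_cos θ).const_sub 1).div_const 2)
    (by fun_prop) (by fun_prop)
  have hlim : (1 - Real.cos 0) / 2 = 0 ∧ (1 - Real.cos Real.pi) / 2 = 1 := by norm_num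
  rw [hlim.1, hlim.2] at h
  rw [← h]
  have hcongr : ∀ θ ∈ uIcc 0 Real.pi,
      ((fun a => (a * (1 - a)) ^ 2 * √(a * (1 - a))) ∘ fun θ => (1 - Real.cos θ) / 2) θ *
        (Real.sin θ / 2) = 1 / 64 * Real.sin θ ^ (2 * 3) := by
    intro θ hθ
    rw [uIcc_of_le Real.pi_pos.le] at hθ
    have hs : (1 - Real.cos θ) / 2 * (1 - (1 - Real.cos θ) / 2) = (Real.sin θ / 2) ^ 2 := by
      rw [div_pow, Real.sin_sq]
      ring
    simp only [Function.comp_apply]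
    rw [hs, Real.sqrt_sq (div_nonneg (Real.sin_nonneg_of_mem_Icc hθ) zero_le_two)]
    ring
  rw [intervalIntegral.integral_congr hcongr, intervalIntegral.integral_const_mul,
    integral_sin_pow_even]
  norm_num [Finset.prod_range_succ]
  ring

theorem lintegral_sq_mul_sqrt_mul_one_sub :
    ∫⁻ a in Ioo (0 : ℝ) 1, ENNReal.ofReal ((a * (1 - a)) ^ 2 * √(a * (1 - a))) =
      ENNReal.ofReal (5 * Real.pi / 1024) := by
  have hc : Continuous fun a : ℝ => (a * (1 - a)) ^ 2 * √(a * (1 - a)) := by fun_prop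
  rw [← integral_sq_mul_sqrt_mul_one_sub, intervalIntegral.integral_of_le zero_le_one,
    integral_Ioc_eq_integral_Ioo, ofReal_integral_eq_lintegral_ofReal
      ((hc.integrableOn_Icc (a := 0) (b := 1)).mono_set Ioo_subset_Icc_self)]
  exact .of_forall fun a => by positivity

theorem lintegral_gapLaw_Ico_neg :
    ∫⁻ v, gapLaw (Ico 0 (-v)) ∂gapLaw = ENNReal.ofReal (47 / 900 + Real.pi / 240) := by
  have hanti : Antitone fun v : ℝ => gapLaw (Ico 0 (-v)) := fun v w h =>
    measure_mono (Ico_subset_Ico_right (neg_le_neg h))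
  have hzero (p q : ℝ) : rectLIntegral (fun v => gapLaw (Ico 0 (-v))) p q = 0 :=
    rectLIntegral_eq_zero (fun u hu => by rw [Ico_eq_empty (by simpa using hu.le), measure_empty])
      p q
  rw [lintegral_gapLaw hanti.measurable]
  simp only [neg_neg, hzero, zero_add, add_zero]
  have hrect : ∀ a ∈ Ioo (0 : ℝ) 1, rectLIntegral (fun u => gapLaw (Ico 0 u)) a (1 - a) +
      rectLIntegral (fun u => gapLaw (Ico 0 u)) (1 - a) a =
      ENNReal.ofReal (a ^ 2 * (1 - a) ^ 2 * -Real.log a) +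
        ENNReal.ofReal ((1 - a) ^ 2 * (1 - (1 - a)) ^ 2 * -Real.log (1 - a)) +
        ENNReal.ofReal (64 / 75) * ENNReal.ofReal ((a * (1 - a)) ^ 2 * √(a * (1 - a))) := by
    intro a ha
    have ha' : 1 - a ∈ Ioo (0 : ℝ) 1 := ⟨sub_pos.2 ha.2, by linarith [ha.1]⟩
    have h₁ := neg_nonneg.2 (Real.log_nonpos ha.1.le ha.2.le)
    have h₂ := neg_nonneg.2 (Real.log_nonpos ha'.1.le ha'.2.le)
    have h₃ : 0 ≤ -(Real.log a + Real.log (1 - a)) / 2 := by linarith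
    have h₄ : 0 ≤ -(Real.log (1 - a) + Real.log a) / 2 := by linarith
    rw [rectLIntegral_gapLaw ha ha', rectLIntegral_gapLaw ha' ha,
      ← ENNReal.ofReal_mul (by norm_num), ← ENNReal.ofReal_add (by positivity) (by positivity),
      ← ENNReal.ofReal_add (by positivity) (by positivity),
      ← ENNReal.ofReal_add (by positivity) (by positivity), Real.sqrt_mul ha.1.le]
    congr 1
    ring
  rw [setLIntegral_congr_fun measurableSet_Ioo hrect, lintegral_add_left (by fun_prop),
    lintegral_add_left (by fun_prop), lintegral_const_mul _ (by fun_prop),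
    setLIntegral_Ioo_one_sub
      (fun a => ENNReal.ofReal (a ^ 2 * (1 - a) ^ 2 * -Real.log a)),
    lintegral_sq_mul_sq_mul_log, lintegral_sq_mul_sqrt_mul_one_sub,
    ← ENNReal.ofReal_mul (by norm_num), ← ENNReal.ofReal_add (by norm_num) (by norm_num),
    ← ENNReal.ofReal_add (by norm_num) (by positivity)]
  congr 1
  ring

theorem gapLaw_Iio_zero : gapLaw (Iio 0) = ENNReal.ofReal (1 / 3) := by
  rw [← lintegral_indicator_one measurableSet_Iio,
    lintegral_gapLaw (measurable_one.indicator measurableSet_Iio)]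
  have hzero (p q : ℝ) : rectLIntegral ((Iio 0).indicator 1) p q = 0 :=
    rectLIntegral_eq_zero (fun u hu => indicator_of_notMem (by simpa using hu.le) _) p q
  have hrect {p q : ℝ} (hp : 0 ≤ p) :
      rectLIntegral (fun u => (Iio 0).indicator (1 : ℝ → ℝ≥0∞) (-u)) p q =
        ENNReal.ofReal (p * q) := by
    have hone : ∀ x ∈ Ioo 0 p, ∫⁻ y in Ioo 0 q, (Iio 0).indicator (1 : ℝ → ℝ≥0∞) (-(x * y)) =
        ENNReal.ofReal q := by
      intro x hx
      have hy : ∀ y ∈ Ioo 0 q, (Iio 0).indicator (1 : ℝ → ℝ≥0∞) (-(x * y)) = 1 := fun y hy =>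
        indicator_of_mem (by simpa using mul_pos hx.1 hy.1) _
      rw [setLIntegral_congr_fun measurableSet_Ioo hy]
      simp
    rw [rectLIntegral, setLIntegral_congr_fun measurableSet_Ioo hone, setLIntegral_const,
      Real.volume_Ioo, sub_zero, mul_comm, ENNReal.ofReal_mul hp]
  have hsum : ∀ a ∈ Ioo (0 : ℝ) 1,
      (rectLIntegral ((Iio 0).indicator 1) a a +
        rectLIntegral (fun u => (Iio 0).indicator (1 : ℝ → ℝ≥0∞) (-u)) a (1 - a)) +
      (rectLIntegral (fun u => (Iio 0).indicator (1 : ℝ → ℝ≥0∞) (-u)) (1 - a) a +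
        rectLIntegral ((Iio 0).indicator 1) (1 - a) (1 - a)) =
      ENNReal.ofReal (2 * a - 2 * a ^ 2) := by
    intro a ha
    have ha' : 0 < 1 - a := sub_pos.2 ha.2
    have ha₀ := ha.1
    rw [hzero, hzero, hrect ha.1.le, hrect ha'.le, zero_add, add_zero,
      ← ENNReal.ofReal_add (by positivity) (by positivity)]
    congr 1
    ring
  rw [setLIntegral_congr_fun measurableSet_Ioo hsum,
    setLIntegral_Ioo_ofReal_deriv (F := fun a => a ^ 2 - 2 / 3 * a ^ 3) zero_le_one]
  · norm_num
  · fun_prop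
  · intro a ha
    refine ((hasDerivAt_pow 2 a).sub ((hasDerivAt_pow 3 a).const_mul (2 / 3))).congr_deriv ?_
    push_cast
    ring
  · intro a ha
    nlinarith [ha.1, ha.2]

theorem gapLaw_prod_add_neg :
    (gapLaw.prod gapLaw) {p | p.1 + p.2 < 0} =
      ENNReal.ofReal (97 / 450 + Real.pi / 120) := by
  set T : Set (ℝ × ℝ) := {p | 0 ≤ p.2 ∧ p.2 < -p.1} with hT
  have hTm : MeasurableSet T :=
    (measurableSet_le measurable_const measurable_snd).inter
      (measurableSet_lt measurable_snd measurable_fst.neg)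
  have hTμ : (gapLaw.prod gapLaw) T = ENNReal.ofReal (47 / 900 + Real.pi / 240) := by
    rw [Measure.prod_apply hTm, ← lintegral_gapLaw_Ico_neg]
    rfl
  have hTμ' : (gapLaw.prod gapLaw) (Prod.swap ⁻¹' T) = (gapLaw.prod gapLaw) T :=
    Measure.measurePreserving_swap.measure_preimage hTm.nullMeasurableSet
  have hset : {p : ℝ × ℝ | p.1 + p.2 < 0} = (Iio 0 ×ˢ Iio 0 ∪ T) ∪ Prod.swap ⁻¹' T := by
    ext ⟨u, v⟩
    simp only [hT, mem_ofPred_eq, mem_union, mem_prod, mem_Iio, mem_preimage, Prod.swap_prod_mk]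
    constructor
    · intro h
      rcases lt_or_ge u 0 with hu | hu
      · rcases lt_or_ge v 0 with hv | hv
        · exact .inl (.inl ⟨hu, hv⟩)
        · exact .inl (.inr ⟨hv, by linarith⟩)
      · exact .inr ⟨hu, by linarith⟩
    · rintro ((⟨hu, hv⟩ | ⟨hv, hu⟩) | ⟨hv, hu⟩) <;> linarith
  rw [hset, measure_union _ (measurable_swap hTm), measure_union _ hTm, Measure.prod_prod,
    gapLaw_Iio_zero, hTμ', hTμ, ← ENNReal.ofReal_mul (by norm_num),
    ← ENNReal.ofReal_add (by norm_num) (by positivity),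
    ← ENNReal.ofReal_add (by positivity) (by positivity)]
  · congr 1
    ring
  · refine disjoint_left.2 fun p hp hp' => ?_
    exact hp'.1.not_gt hp.2
  · refine disjoint_left.2 fun p hp hp' => ?_
    have h₁ : 0 ≤ p.1 := hp'.1
    rcases hp with hp | hp
    · exact h₁.not_gt hp.1
    · have h₂ := hp.1
      have h₃ := hp.2
      linarith

/-- Lebesgue measure on the open unit square. -/
noncomputable def squareMeasure : Measure (ℝ × ℝ) := unitMeasure.prod unitMeasure

instance : IsProbabilityMeasure squareMeasure := by
  unfold squareMeasure
  infer_instance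

theorem squareMeasure_eq_restrict :
    squareMeasure = volume.restrict (Icc (0 : ℝ) 1 ×ˢ Icc (0 : ℝ) 1) := by
  rw [squareMeasure, unitMeasure, Measure.restrict_congr_set Ioo_ae_eq_Icc, Measure.prod_restrict]
  rfl

/-- The triples of points whose angle at the first vertex is obtuse. -/
def obtuseAtFirst : Set ((ℝ × ℝ) × (ℝ × ℝ) × (ℝ × ℝ)) :=
  {t | sqDist t.2.1 t.2.2 > sqDist t.1 t.2.2 + sqDist t.1 t.2.1}

theorem measurableSet_obtuseAtFirst : MeasurableSet obtuseAtFirst :=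
  measurableSet_lt (by unfold sqDist; fun_prop) (by unfold sqDist; fun_prop)

theorem measure_obtuseAtFirst :
    (squareMeasure.prod (squareMeasure.prod squareMeasure)) obtuseAtFirst =
      ENNReal.ofReal (97 / 450 + Real.pi / 120) := by
  have hshuffle := (measurePreserving_prodProdProdComm unitMeasure unitMeasure
    (unitMeasure.prod unitMeasure) (unitMeasure.prod unitMeasure)).comp
    ((MeasurePreserving.id squareMeasure).prod
      (measurePreserving_prodProdProdComm unitMeasure unitMeasure unitMeasure unitMeasure))
  have hgap : MeasurePreserving (fun p : ℝ × ℝ × ℝ => (p.2.1 - p.1) * (p.2.2 - p.1))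
      (unitMeasure.prod (unitMeasure.prod unitMeasure)) gapLaw := ⟨measurable_gap, rfl⟩
  have hm : MeasurableSet {p : ℝ × ℝ | p.1 + p.2 < 0} :=
    measurableSet_lt (by fun_prop) measurable_const
  rw [← gapLaw_prod_add_neg,
    ← ((hgap.prod hgap).comp hshuffle).measure_preimage hm.nullMeasurableSet]
  congr 1
  ext ⟨⟨a, a'⟩, ⟨b, b'⟩, ⟨c, c'⟩⟩
  simp only [obtuseAtFirst, sqDist, mem_ofPred_eq, mem_preimage, Function.comp_apply, Prod.map,
    id_eq]
  constructor <;> intro h <;> nlinarith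

theorem measure_setOf_isObtuse :
    (squareMeasure.prod (squareMeasure.prod squareMeasure)) {t | IsObtuse t.1 t.2.1 t.2.2} =
      ENNReal.ofReal (97 / 150 + Real.pi / 40) := by
  have hrot : MeasurePreserving
      (fun t : (ℝ × ℝ) × (ℝ × ℝ) × (ℝ × ℝ) => (t.2.1, t.2.2, t.1))
      (squareMeasure.prod (squareMeasure.prod squareMeasure))
      (squareMeasure.prod (squareMeasure.prod squareMeasure)) :=
    (measurePreserving_prodAssoc squareMeasure squareMeasure squareMeasure).comp
      Measure.measurePreserving_swap
  have hm := measurableSet_obtuseAtFirst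
  have hB := hrot.measure_preimage hm.nullMeasurableSet
  have hC := (hrot.comp hrot).measure_preimage hm.nullMeasurableSet
  rw [measure_obtuseAtFirst] at hB hC
  set ρ : (ℝ × ℝ) × (ℝ × ℝ) × (ℝ × ℝ) → (ℝ × ℝ) × (ℝ × ℝ) × (ℝ × ℝ) :=
    fun t => (t.2.1, t.2.2, t.1) with hρ
  have hset : {t : (ℝ × ℝ) × (ℝ × ℝ) × (ℝ × ℝ) | IsObtuse t.1 t.2.1 t.2.2} =
      (obtuseAtFirst ∪ ρ ⁻¹' obtuseAtFirst) ∪ (ρ ∘ ρ) ⁻¹' obtuseAtFirst := by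
    ext ⟨⟨a, a'⟩, ⟨b, b'⟩, ⟨c, c'⟩⟩
    simp only [hρ, IsObtuse, obtuseAtFirst, sqDist, mem_ofPred_eq, mem_union, mem_preimage,
      Function.comp_apply, or_assoc]
    refine or_congr_right (or_congr ?_ ?_) <;> constructor <;> intro h <;> linarith
  rw [hset, measure_union _ ((hrot.comp hrot).measurable hm),
    measure_union _ (hrot.measurable hm), hB, hC, measure_obtuseAtFirst,
    ← ENNReal.ofReal_add (by positivity) (by positivity),
    ← ENNReal.ofReal_add (by positivity) (by positivity)]
  · congr 1
    ring
  · refine disjoint_left.2 ?_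
    rintro ⟨⟨a, a'⟩, ⟨b, b'⟩, ⟨c, c'⟩⟩ h h'
    simp only [hρ, obtuseAtFirst, sqDist, mem_ofPred_eq, mem_preimage] at h h'
    nlinarith [sq_nonneg (a - b), sq_nonneg (a' - b')]
  · refine disjoint_left.2 ?_
    rintro ⟨⟨a, a'⟩, ⟨b, b'⟩, ⟨c, c'⟩⟩ h h'
    simp only [hρ, obtuseAtFirst, sqDist, mem_ofPred_eq, mem_preimage, mem_union,
      Function.comp_apply] at h h'
    rcases h with h | h
    · nlinarith [sq_nonneg (a - c), sq_nonneg (a' - c')]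
    · nlinarith [sq_nonneg (b - c), sq_nonneg (b' - c')]

/-- The probability that a triangle with three vertices chosen independently
and uniformly in the unit square is obtuse equals `97/150 + π/40`: the
six-dimensional Lebesgue measure of the set of obtuse triples in
`([0,1]²)³` is `97/150 + π/40`. -/
theorem stmt_8 :
    volume {t : (ℝ × ℝ) × (ℝ × ℝ) × (ℝ × ℝ) |
        t.1 ∈ Set.Icc (0:ℝ) 1 ×ˢ Set.Icc (0:ℝ) 1 ∧
        t.2.1 ∈ Set.Icc (0:ℝ) 1 ×ˢ Set.Icc (0:ℝ) 1 ∧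
        t.2.2 ∈ Set.Icc (0:ℝ) 1 ×ˢ Set.Icc (0:ℝ) 1 ∧
        IsObtuse t.1 t.2.1 t.2.2}
      = ENNReal.ofReal (97 / 150 + Real.pi / 40) := by
  have hm : MeasurableSet ((Icc (0 : ℝ) 1 ×ˢ Icc (0 : ℝ) 1) ×ˢ (Icc (0 : ℝ) 1 ×ˢ Icc (0 : ℝ) 1) ×ˢ
      (Icc (0 : ℝ) 1 ×ˢ Icc (0 : ℝ) 1)) := by measurability
  rw [← measure_setOf_isObtuse, squareMeasure_eq_restrict, Measure.prod_restrict,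
    Measure.prod_restrict, Measure.restrict_apply' hm]
  change volume _ = volume _
  congr 1
  ext t
  simp only [mem_ofPred_eq, mem_inter_iff, mem_prod]
  tauto
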